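/- arXiv:1301.4957 — 3 statements merged into one kernel-verified Lean document; each statement's English description precedes it below -/
import Mathlib

section
/- Let r, q, m, k be natural numbers with k = m + r + 1 + q and m > r + 1. Let a : ℕ → ℝ satisfy a(p) > 0 for all p ≤ k, a(0) = 1, a(k) = 1, and the log-concavity condition a(p−1)·a(p+1) ≤ a(p)^2 for all 1 ≤ p ≤ k−1. Define b(p) = a(k−p) for p ≤ k. Assume that a(m) ≥ a(1)^m, a(k−r−1) ≥ a(1)^m, b(m) ≥ b(1)^m, and b(k−r−1) ≥ b(1)^m. Then a(1) = 1. -/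
/-- Consecutive ratios of a positive log-concave sequence starting at `1` are at most `a 1`. -/
theorem logConcave_succ_le_mul {k : ℕ} {a : ℕ → ℝ} (hpos : ∀ p ≤ k, 0 < a p) (ha0 : a 0 = 1)
    (hconc : ∀ p, 1 ≤ p → p + 1 ≤ k → a (p - 1) * a (p + 1) ≤ (a p) ^ 2)
    (p : ℕ) (hp : p + 1 ≤ k) : a (p + 1) ≤ a 1 * a p := by
  induction p with
  | zero => simp [ha0]
  | succ n ih =>
    have hn := hpos n (by omega)
    have hn1 := hpos (n + 1) (by omega)
    have hc := hconc (n + 1) (by omega) hp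
    rw [Nat.add_sub_cancel] at hc
    refine le_of_mul_le_mul_left ?_ hn
    calc a n * a (n + 1 + 1) ≤ a (n + 1) * a (n + 1) := by rw [← sq]; exact hc
      _ ≤ a (n + 1) * (a 1 * a n) := mul_le_mul_of_nonneg_left (ih (by omega)) hn1.le
      _ = a n * (a 1 * a (n + 1)) := by ring

/-- A positive log-concave sequence starting at `1` satisfies `a p ≤ a 1 ^ p`. -/
theorem logConcave_le_pow {k : ℕ} {a : ℕ → ℝ} (hpos : ∀ p ≤ k, 0 < a p) (ha0 : a 0 = 1)
    (hconc : ∀ p, 1 ≤ p → p + 1 ≤ k → a (p - 1) * a (p + 1) ≤ (a p) ^ 2)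
    (p : ℕ) (hp : p ≤ k) : a p ≤ a 1 ^ p := by
  induction p with
  | zero => simp [ha0]
  | succ n ih =>
    rw [pow_succ']
    exact (logConcave_succ_le_mul hpos ha0 hconc n hp).trans
      (mul_le_mul_of_nonneg_left (ih (by omega)) (hpos 1 (by omega)).le)

/-- Numerical core of Theorem 1.1: a positive log-concave sequence with
`a 0 = a k = 1`, whose reversal is `b`, satisfying the stated growth
inequalities at `m` and `k - r - 1` for both `a` and `b`, must have `a 1 = 1`. -/
theorem logConcave_first_degree_eq_one
    (r q m k : ℕ) (hk : k = m + r + 1 + q) (hm : m > r + 1)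
    (a b : ℕ → ℝ)
    (hb : ∀ p ≤ k, b p = a (k - p))
    (hpos : ∀ p ≤ k, 0 < a p)
    (ha0 : a 0 = 1) (hak : a k = 1)
    (hconc : ∀ p, 1 ≤ p → p + 1 ≤ k → a (p - 1) * a (p + 1) ≤ (a p) ^ 2)
    (h1 : a m ≥ a 1 ^ m)
    (h2 : a (k - r - 1) ≥ a 1 ^ m)
    (h3 : b m ≥ b 1 ^ m)
    (h4 : b (k - r - 1) ≥ b 1 ^ m) :
    a 1 = 1 := by
  have hbpos : ∀ p ≤ k, 0 < b p := fun p hp => by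
    rw [hb p hp]; exact hpos _ (Nat.sub_le _ _)
  have hb0 : b 0 = 1 := by rw [hb 0 (Nat.zero_le _), Nat.sub_zero, hak]
  have hbconc : ∀ p, 1 ≤ p → p + 1 ≤ k → b (p - 1) * b (p + 1) ≤ (b p) ^ 2 := by
    intro p hp hpk
    have hc := hconc (k - p) (by omega) (by omega)
    rw [hb _ (by omega), hb _ hpk, hb _ (by omega), mul_comm]
    rwa [show k - p - 1 = k - (p + 1) by omega, show k - p + 1 = k - (p - 1) by omega] at hc
  have hab : a 1 ^ m ≤ b 1 ^ (r + 1) := by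
    refine h2.le.trans ?_
    rw [Nat.sub_sub, ← hb (r + 1) (by omega)]
    exact logConcave_le_pow hbpos hb0 hbconc _ (by omega)
  have hba : b 1 ^ m ≤ a 1 ^ (r + 1) := by
    refine h4.le.trans ?_
    rw [hb _ (by omega), show k - (k - r - 1) = r + 1 by omega]
    exact logConcave_le_pow hpos ha0 hconc _ (by omega)
  have ha1 : 0 < a 1 := hpos 1 (by omega)
  have hb1 : 0 < b 1 := hbpos 1 (by omega)
  have hpow : a 1 ^ (m * m) ≤ a 1 ^ ((r + 1) * (r + 1)) := by
    calc a 1 ^ (m * m) = (a 1 ^ m) ^ m := pow_mul _ _ _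
      _ ≤ (b 1 ^ (r + 1)) ^ m := pow_le_pow_left₀ (by positivity) hab _
      _ = (b 1 ^ m) ^ (r + 1) := pow_right_comm _ _ _
      _ ≤ (a 1 ^ (r + 1)) ^ (r + 1) := pow_le_pow_left₀ (by positivity) hba _
      _ = a 1 ^ ((r + 1) * (r + 1)) := (pow_mul _ _ _).symm
  apply le_antisymm
  · by_contra! h
    exact (pow_lt_pow_right₀ h (Nat.mul_self_lt_mul_self hm)).not_ge hpow
  · by_contra! h
    have hk1 := logConcave_le_pow hpos ha0 hconc k le_rfl
    rw [hak] at hk1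
    exact (pow_lt_one₀ ha1.le h (by omega)).not_ge hk1
end

section
/- Let r, q, s, k be natural numbers with k = s + r + 1 + q and s > r + 1. Let m : ℕ → ℝ satisfy m(0) = 0, m(k) = 0, m(1) ≥ 0, m(k−1) ≥ 0, and the concavity condition m(p−1) + m(p+1) ≤ 2·m(p) for all 1 ≤ p ≤ k−1. Define n(p) = m(k−p) for p ≤ k. Assume that m(s) ≥ s·m(1), m(k−r−1) ≥ s·m(1), n(s) ≥ s·n(1), and n(k−r−1) ≥ s·n(1). Then m(1) = 0. -/
/-- A concave sequence vanishing at `0` lies below the line through its first two terms. -/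
theorem le_mul_of_concave {k : ℕ} {c : ℕ → ℝ} (h0 : c 0 = 0)
    (hc : ∀ p, 1 ≤ p → p + 1 ≤ k → c (p - 1) + c (p + 1) ≤ 2 * c p) {j : ℕ} (hj : j ≤ k) :
    c j ≤ j * c 1 := by
  have step : ∀ p, p + 1 ≤ k → c (p + 1) - c p ≤ c 1 := by
    intro p
    induction p with
    | zero => simp [h0]
    | succ p ih =>
      intro hp
      have h := hc (p + 1) (by omega) hp
      rw [Nat.add_sub_cancel] at h
      linarith [ih (by omega)]
  induction j with
  | zero => simp [h0]
  | succ j ih =>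
    push_cast
    linarith [ih (by omega), step j hj]


/-- Numerical core of Theorem 1.2: a concave real sequence with
`m 0 = m k = 0`, `m 1 ≥ 0`, `m (k-1) ≥ 0`, whose reversal is `n`, satisfying
the stated growth inequalities at `s` and `k - r - 1` for both `m` and `n`,
must have `m 1 = 0`. -/
theorem concave_first_exponent_eq_zero
    (r q s k : ℕ) (hk : k = s + r + 1 + q) (hs : s > r + 1)
    (m n : ℕ → ℝ)
    (hn : ∀ p ≤ k, n p = m (k - p))
    (hm0 : m 0 = 0) (hmk : m k = 0)
    (hm1 : m 1 ≥ 0) (hmk1 : m (k - 1) ≥ 0)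
    (hconc : ∀ p, 1 ≤ p → p + 1 ≤ k → m (p - 1) + m (p + 1) ≤ 2 * m p)
    (h1 : m s ≥ (s : ℝ) * m 1)
    (h2 : m (k - r - 1) ≥ (s : ℝ) * m 1)
    (h3 : n s ≥ (s : ℝ) * n 1)
    (h4 : n (k - r - 1) ≥ (s : ℝ) * n 1) :
    m 1 = 0 := by
  have hn_conc : ∀ p, 1 ≤ p → p + 1 ≤ k → n (p - 1) + n (p + 1) ≤ 2 * n p := by
    intro p hp hpk
    have h := hconc (k - p) (by omega) (by omega)
    rw [hn _ (by omega), hn _ hpk, hn p (by omega), show k - (p - 1) = k - p + 1 by omega,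
      show k - (p + 1) = k - p - 1 by omega]
    linarith
  have hn0 : n 0 = 0 := by rw [hn 0 k.zero_le, Nat.sub_zero, hmk]
  have hn1 : 0 ≤ n 1 := by rwa [hn 1 (by omega)]
  have hm_le := le_mul_of_concave hm0 hconc (j := r + 1) (by omega)
  have hn_le := le_mul_of_concave hn0 hn_conc (j := r + 1) (by omega)
  rw [hn _ (by omega), ← Nat.sub_sub] at hn_le
  rw [hn _ (by omega), show k - (k - r - 1) = r + 1 by omega] at h4
  have hs' : ((r + 1 : ℕ) : ℝ) < s := by exact_mod_cast hs
  nlinarith [mul_nonneg (sub_nonneg.2 hs'.le) hn1]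
end

section
/- Let m ≥ 2 be a natural number, let k : Fin m → ℕ be monotone with 1 ≤ k(i) for all i (so k(0) ≤ k(1) ≤ ⋯ ≤ k(m−1)), and let c : Fin m → ℝ with c(i) ≥ 0 for all i. Consider the multivariate polynomial ring ℝ[X₀, …, X_{m−1}] and the ideal I generated by the monomials X_i^{k(i)+1} for all i. If (∑_i c(i)·X_i)^{k(0)+k(1)} ∈ I, then there is at most one index i with c(i) ≠ 0 (i.e., for all i ≠ j, c(i) = 0 or c(j) = 0). -/
open MvPolynomial in
/-- Each exponent in the support of an element of the ideal generated by the powers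
`X i ^ d i` has some coordinate `i` at least `d i`. -/
lemma MvPolynomial.exists_le_of_mem_span_range_X_pow {σ R : Type*} [CommSemiring R]
    {d : σ → ℕ} {p : MvPolynomial σ R}
    (hp : p ∈ Ideal.span (Set.range fun i => (X i : MvPolynomial σ R) ^ d i))
    {s : σ →₀ ℕ} (hs : p.coeff s ≠ 0) : ∃ i, d i ≤ s i := by
  have hrange : (Set.range fun i => (X i : MvPolynomial σ R) ^ d i) =
      (fun s => monomial s (1 : R)) '' Set.range fun i => Finsupp.single i (d i) := by
    rw [← Set.range_comp]
    simp only [X_pow_eq_monomial, Function.comp_def]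
  rw [hrange, mem_ideal_span_monomial_image] at hp
  obtain ⟨_, ⟨i, rfl⟩, hi⟩ := hp s (mem_support_iff.mpr hs)
  exact ⟨i, by simpa using hi i⟩

open MvPolynomial in
/-- If the power `a + b` of a linear form lies in the ideal generated by the
`X i ^ (k i + 1)`, then two coefficients whose variables tolerate the exponents `a` and `b`
cannot both be nonzero. -/
lemma MvPolynomial.eq_zero_or_eq_zero_of_linear_pow_mem {σ R : Type*} [Fintype σ]
    [CommRing R] [IsDomain R] [CharZero R] {k : σ → ℕ} {c : σ → R} {a b : ℕ}
    (h : (∑ i, C (c i) * X i : MvPolynomial σ R) ^ (a + b) ∈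
      Ideal.span (Set.range fun i => (X i : MvPolynomial σ R) ^ (k i + 1)))
    {i j : σ} (hij : i ≠ j) (ha : a ≤ k i) (hb : b ≤ k j) : c i = 0 ∨ c j = 0 := by
  classical
  by_contra! hc
  obtain ⟨hci, hcj⟩ := hc
  set s : σ →₀ ℕ := Finsupp.single i a + Finsupp.single j b with hs
  have hsum : (s.sum fun _ n => n) = a + b := by
    rw [hs, Finsupp.sum_add_index' (by simp) (by simp)]
    simp
  have hcoeff : ((∑ i, C (c i) * X i : MvPolynomial σ R) ^ (a + b)).coeff s ≠ 0 := by
    simp_rw [← smul_eq_C_mul]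
    rw [coeff_linearCombination_X_pow_of_fintype, if_pos hsum]
    refine mul_ne_zero (Nat.cast_ne_zero.mpr ?_) ?_
    · rw [Finsupp.multinomial_eq]
      exact (Nat.multinomial_pos _ _).ne'
    · rw [Finsupp.prod_add_index' (by simp) (by simp [pow_add])]
      simp [hci, hcj]
  obtain ⟨r, hr⟩ := exists_le_of_mem_span_range_X_pow h hcoeff
  simp only [hs, Finsupp.add_apply, Finsupp.single_apply] at hr
  split_ifs at hr <;> grind

open MvPolynomial in
/-- If a nonnegative combination `∑ cᵢ Xᵢ` in `ℝ[X₀,…,X_{m-1}]` raised to the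
power `k 0 + k 1` lies in the ideal generated by the `Xᵢ^{k i + 1}` (with
`k` monotone, `k i ≥ 1`), then at most one coefficient `c i` is nonzero. -/
theorem multiprojective_nef_power_in_ideal
    (m : ℕ) (hm : 2 ≤ m) (k : Fin m → ℕ) (hkmono : Monotone k)
    (hk1 : ∀ i, 1 ≤ k i) (c : Fin m → ℝ) (hc : ∀ i, 0 ≤ c i)
    (h : ((∑ i, C (c i) * X i : MvPolynomial (Fin m) ℝ)) ^
          (k ⟨0, by omega⟩ + k ⟨1, by omega⟩) ∈
        Ideal.span (Set.range fun i : Fin m =>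
          (X i : MvPolynomial (Fin m) ℝ) ^ (k i + 1))) :
    ∀ i j : Fin m, i ≠ j → c i = 0 ∨ c j = 0 := by
  intro i j hij
  wlog hlt : i < j generalizing i j
  · exact (this j i hij.symm (hij.lt_or_gt.resolve_left hlt)).symm
  refine eq_zero_or_eq_zero_of_linear_pow_mem h hij (hkmono ?_) (hkmono ?_)
  · exact Nat.zero_le _
  · exact Nat.one_le_of_lt hlt
end
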